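/- Fix a positive integer j and let u, s_1, …, s_j, r_1, …, r_j denote the distinguished elements of the poset P_j. If 2 ≤ k ≤ j and 𝒞 is a k-saturated chain partition of P_j, then u lies on the same chain of 𝒞 as either r_{k-1} or r_k. Moreover, in every 1-saturated chain partition of P_j, u lies on the same chain as r_1, and in every (j+1)-saturated chain partition of P_j, u lies on the same chain as r_j. -/

import Mathlib

/-- The maximum cardinality of a union of `k` antichains (a `k`-family)
with respect to the relation `r`. -/
noncomputable def dFam {α : Type*} (r : α → α → Prop) (k : ℕ) : ℕ :=
  sSup {n | ∃ A : Fin k → Set α, (∀ i, IsAntichain r (A i)) ∧ (⋃ i, A i).ncard = n}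

/-- The height of a poset: the maximum cardinality of a chain. -/
noncomputable def heightPO {α : Type*} (r : α → α → Prop) : ℕ :=
  sSup {n | ∃ s : Set α, IsChain r s ∧ s.ncard = n}

/-- The width of a poset: the maximum cardinality of an antichain. -/
noncomputable def widthPO {α : Type*} (r : α → α → Prop) : ℕ :=
  sSup {n | ∃ s : Set α, IsAntichain r s ∧ s.ncard = n}

/-- `f` encodes a partition of `α` into chains: its (nonempty) fibers are the chains. -/
def IsChainPartition {α : Type*} (r : α → α → Prop) (f : α → α) : Prop :=
  ∀ i : α, IsChain r (f ⁻¹' {i})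

/-- The `k`-norm of the partition encoded by `f`: `Σ_C min (k, |C|)`. -/
noncomputable def knorm {α : Type*} [Fintype α] (f : α → α) (k : ℕ) : ℕ :=
  ∑ i : α, min k (f ⁻¹' {i}).ncard

/-- A poset is polyunsaturated if no chain partition is simultaneously `k`- and
`l`-saturated for distinct nonconsecutive positive `k, l` below the height. -/
def PolyunsatPO {α : Type*} [Fintype α] (r : α → α → Prop) : Prop :=
  ∀ k l : ℕ, 0 < k → 0 < l → k < heightPO r → l < heightPO r →
    (k + 2 ≤ l ∨ l + 2 ≤ k) →
    ¬ ∃ f : α → α, IsChainPartition r f ∧ knorm f k = dFam r k ∧ knorm f l = dFam r l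

/-- A poset has order dimension at most 2: two linear extensions whose
intersection is the order. -/
def DimLE2 {α : Type*} (r : α → α → Prop) : Prop :=
  ∃ L₁ L₂ : α → α → Prop, IsLinearOrder α L₁ ∧ IsLinearOrder α L₂ ∧
    (∀ x y, r x y → L₁ x y) ∧ (∀ x y, r x y → L₂ x y) ∧
    (∀ x y, r x y ↔ L₁ x y ∧ L₂ x y)


/-- Size of the chain `Q i` in the construction of the poset `P j`. -/
def qsize (i : ℕ) : ℕ := if i = 1 then 3 else i + 1

/-- Position (from the bottom) of the element `s i` within the chain `Q i`. -/
def sposn (i : ℕ) : ℕ := qsize i - 2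

/-- The underlying set of the poset `P j`: pairs `(i, m)` where `1 ≤ i ≤ j` indexes
the chain `Q i` and `m < qsize i` is the position within that chain. -/
def PJ (j : ℕ) : Type :=
  {p : Fin (j + 1) × Fin (j + 2) // 1 ≤ p.1.val ∧ p.1.val ≤ j ∧ p.2.val < qsize p.1.val}

instance (j : ℕ) : Fintype (PJ j) := by unfold PJ; infer_instance

instance (j : ℕ) : DecidableEq (PJ j) := by unfold PJ; infer_instance

/-- The order relation of `P j`. -/
def ple {j : ℕ} (x y : PJ j) : Prop :=
  (x.val.1.val = y.val.1.val ∧ x.val.2.val ≤ y.val.2.val) ∨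
  (x.val.1.val < y.val.1.val ∧ x.val.2.val ≤ sposn x.val.1.val ∧
    sposn y.val.1.val ≤ y.val.2.val)

instance (j : ℕ) : PartialOrder (PJ j) where
  le := ple
  le_refl x := Or.inl ⟨rfl, le_rfl⟩
  le_trans x y z hxy hyz := by
    simp only [ple] at hxy hyz ⊢
    rcases hxy with ⟨h1, h2⟩ | ⟨h1, h2, h3⟩ <;> rcases hyz with ⟨g1, g2⟩ | ⟨g1, g2, g3⟩
    · exact Or.inl ⟨h1.trans g1, h2.trans g2⟩
    · refine Or.inr ⟨by omega, ?_, g3⟩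
      rw [h1]; omega
    · refine Or.inr ⟨by omega, h2, ?_⟩
      rw [← g1]; omega
    · exact Or.inr ⟨by omega, h2, g3⟩
  le_antisymm x y hxy hyx := by
    simp only [ple] at hxy hyx
    rcases hxy with ⟨h1, h2⟩ | ⟨h1, h2, h3⟩ <;> rcases hyx with ⟨g1, g2⟩ | ⟨g1, g2, g3⟩
    · exact Subtype.ext (Prod.ext (Fin.ext h1) (Fin.ext (le_antisymm h2 g2)))
    all_goals (exfalso; omega)

/-- The order of `P j`, as an explicit relation. -/
def pjle (j : ℕ) : PJ j → PJ j → Prop := (· ≤ ·)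

/-- The element `u` of `P j`. -/
def uElt (j : ℕ) (hj : 1 ≤ j) : PJ j :=
  ⟨(⟨1, by omega⟩, ⟨0, by omega⟩), le_refl 1, hj, by show 0 < qsize 1; decide⟩

/-- The element `s i` of `P j`. -/
def sElt (j i : ℕ) (h1 : 1 ≤ i) (h2 : i ≤ j) : PJ j :=
  ⟨(⟨i, by omega⟩, ⟨sposn i, by simp only [sposn, qsize]; split <;> omega⟩),
    h1, h2, by show sposn i < qsize i; simp only [sposn, qsize]; split <;> omega⟩

/-- The element `r i` of `P j`. -/
def rElt (j i : ℕ) (h1 : 1 ≤ i) (h2 : i ≤ j) : PJ j :=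
  ⟨(⟨i, by omega⟩, ⟨qsize i - 1, by simp only [qsize]; split <;> omega⟩),
    h1, h2, by show qsize i - 1 < qsize i; simp only [qsize]; split <;> omega⟩


theorem IsChain.eq_of_mem_isAntichain {α : Type*} {r : α → α → Prop} {s t : Set α} {x y : α}
    (hs : IsChain r s) (ht : IsAntichain r t) (hxs : x ∈ s) (hys : y ∈ s)
    (hxt : x ∈ t) (hyt : y ∈ t) : x = y := by
  by_contra h
  rcases hs hxs hys h with hr | hr
  · exact ht hxt hyt h hr
  · exact ht hyt hxt (Ne.symm h) hr

/-- If the elements `x` with `lev x ∈ [1, k]` form a `k`-family, and every part of the chain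
partition `g` is contained in this family or meets each of its `k` levels, then the family has
maximum cardinality. -/
theorem dFam_le_card_of_slack {α β : Type*} [Fintype α] {r : α → α → Prop} {k : ℕ}
    {lev : α → ℕ} {g : α → β} (hg : ∀ b, IsChain r (g ⁻¹' {b}))
    (hslack : ∀ x, lev x ∉ Finset.Icc 1 k → ∀ m ∈ Finset.Icc 1 k, ∃ y, g y = g x ∧ lev y = m) :
    dFam r k ≤ (Finset.univ.filter fun x => lev x ∈ Finset.Icc 1 k).card := by
  classical
  refine csSup_le' ?_
  rintro n ⟨A, hA, rfl⟩
  rw [Set.ncard_eq_toFinset_card',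
    Finset.card_eq_sum_card_fiberwise (f := g) (t := Finset.univ.image g)
      fun x _ => Finset.mem_coe.2 (Finset.mem_image_of_mem g (Finset.mem_univ x)),
    Finset.card_eq_sum_card_fiberwise (f := g) (t := Finset.univ.image g)
      fun x _ => Finset.mem_coe.2 (Finset.mem_image_of_mem g (Finset.mem_univ x))]
  refine Finset.sum_le_sum fun b _ => ?_
  by_cases hb : ∃ x, g x = b ∧ lev x ∉ Finset.Icc 1 k
  · obtain ⟨x, rfl, hx⟩ := hb
    calc _ ≤ (Finset.univ : Finset (Fin k)).card := by
          have hex : ∀ y : α, ∃ i : Option (Fin k), y ∈ ⋃ i, A i → ∃ i', i = some i' ∧ y ∈ A i' := by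
            intro y
            by_cases hy : y ∈ ⋃ i, A i
            · obtain ⟨i, hi⟩ := Set.mem_iUnion.1 hy
              exact ⟨some i, fun _ => ⟨i, rfl, hi⟩⟩
            · exact ⟨none, fun h => absurd h hy⟩
          choose c hc using hex
          rw [← Finset.card_image_of_injective _ (Option.some_injective (Fin k))]
          refine Finset.card_le_card_of_injOn c ?_ ?_
          · intro y hy
            simp only [Finset.coe_filter, Set.mem_toFinset, Set.mem_ofPred_eq] at hy
            obtain ⟨i, hi, -⟩ := hc y hy.1
            simp [hi]
          · intro y hy z hz hyz
            simp only [Finset.coe_filter, Set.mem_toFinset, Set.mem_ofPred_eq] at hy hz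
            obtain ⟨i, hi, hyi⟩ := hc y hy.1
            obtain ⟨i', hi', hzi⟩ := hc z hz.1
            obtain rfl : i = i' := Option.some_injective _ (by rw [← hi, ← hi', hyz])
            exact (hg (g x)).eq_of_mem_isAntichain (hA i) hy.2 hz.2 hyi hzi
      _ = (Finset.Icc 1 k).card := by simp
      _ ≤ _ := by
          refine (Finset.card_le_card ?_).trans (Finset.card_image_le (f := lev))
          intro m hm
          obtain ⟨y, hy, rfl⟩ := hslack x hx m hm
          exact Finset.mem_image_of_mem _ (by simp_all)
  · push Not at hb
    refine Finset.card_le_card fun y hy => ?_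
    simp only [Finset.mem_filter, Finset.mem_univ, true_and] at hy ⊢
    exact ⟨hb y hy.2, hy.2⟩

/-- In a saturated chain partition, every chain not contained in a given maximum `k`-family
meets each of its `k` levels. -/
theorem exists_level_of_knorm_eq {α β : Type*} [Fintype α] {r : α → α → Prop} {k : ℕ}
    {lev : α → ℕ} (hlev : ∀ m ∈ Finset.Icc 1 k, IsAntichain r {x | lev x = m})
    {g : α → β} (hg : ∀ b, IsChain r (g ⁻¹' {b}))
    (hslack : ∀ x, lev x ∉ Finset.Icc 1 k → ∀ m ∈ Finset.Icc 1 k, ∃ y, g y = g x ∧ lev y = m)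
    {f : α → α} (hf : IsChainPartition r f) (hk : knorm f k = dFam r k)
    {x : α} (hx : lev x ∉ Finset.Icc 1 k) {m : ℕ} (hm : m ∈ Finset.Icc 1 k) :
    ∃ y, f y = f x ∧ lev y = m := by
  classical
  set F := Finset.univ.filter fun x => lev x ∈ Finset.Icc 1 k with hF
  have hinj : ∀ i, Set.InjOn lev (F.filter (f · = i) : Finset α) := by
    intro i y hy z hz hyz
    simp only [hF, Finset.coe_filter, Finset.mem_filter, Finset.mem_univ, true_and,
      Set.mem_ofPred_eq] at hy hz
    exact (hf i).eq_of_mem_isAntichain (hlev _ hy.1) hy.2 hz.2 rfl hyz.symm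
  have hmaps : ∀ i, (F.filter (f · = i)).image lev ⊆ Finset.Icc 1 k := by
    intro i n hn
    obtain ⟨y, hy, rfl⟩ := Finset.mem_image.1 hn
    exact (Finset.mem_filter.1 (Finset.mem_filter.1 hy).1).2
  have hfib : ∀ i, (f ⁻¹' {i}).ncard = (Finset.univ.filter (f · = i)).card := by
    intro i
    rw [Set.ncard_eq_toFinset_card']
    congr 1
    ext y
    simp
  have hle : ∀ i ∈ Finset.univ, (F.filter (f · = i)).card ≤ min k (f ⁻¹' {i}).ncard := by
    intro i _
    refine le_min ?_ ?_
    · rw [← Finset.card_image_of_injOn (hinj i)]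
      simpa using Finset.card_le_card (hmaps i)
    · rw [hfib]
      exact Finset.card_le_card (Finset.filter_subset_filter _ (Finset.subset_univ _))
  have hsum : ∑ i, (F.filter (f · = i)).card = ∑ i, min k (f ⁻¹' {i}).ncard := by
    refine le_antisymm (Finset.sum_le_sum hle) ?_
    rw [← Finset.card_eq_sum_card_fiberwise fun y _ => Finset.mem_coe.2 (Finset.mem_univ (f y))]
    exact hk.le.trans (dFam_le_card_of_slack hg hslack)
  have heq := (Finset.sum_eq_sum_iff_of_le hle).1 hsum (f x) (Finset.mem_univ _)
  have hlt : (F.filter (f · = f x)).card < (f ⁻¹' {f x}).ncard := by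
    rw [hfib]
    refine Finset.card_lt_card (Finset.ssubset_iff_of_subset
      (Finset.filter_subset_filter _ (Finset.subset_univ _)) |>.2 ⟨x, by simp, ?_⟩)
    simpa [hF] using hx
  have hcard : k ≤ (F.filter (f · = f x)).card := by omega
  have himage := Finset.eq_of_subset_of_card_le (hmaps (f x))
    (by rw [Finset.card_image_of_injOn (hinj _)]; simpa using hcard)
  rw [← himage] at hm
  obtain ⟨y, hy, rfl⟩ := Finset.mem_image.1 hm
  exact ⟨y, (Finset.mem_filter.1 hy).2, rfl⟩

/-- Levels in `P j`: `[1, k]` are the levels of a `k`-family which omits `u` and `s k`. -/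
def pjLevel (k : ℕ) {j : ℕ} (x : PJ j) : ℕ :=
  if x.val.1.val = k ∧ x.val.2.val + 2 = qsize k then 0
  else if x.val.1.val = k ∧ x.val.2.val + 1 = qsize k then k
  else if x.val.1.val = 1 then x.val.2.val else x.val.2.val + 1

/-- The chain `u < s 1 < ⋯ < s n < r n` in `P j`, where `n = min k j`. -/
def InLongChain (k : ℕ) {j : ℕ} (x : PJ j) : Prop :=
  x.val.1.val ≤ k ∧ (x.val.1.val = 1 ∧ x.val.2.val = 0 ∨ x.val.2.val = sposn x.val.1.val ∨
    x.val.1.val = min k j ∧ x.val.2.val + 1 = qsize x.val.1.val)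

open Classical in
/-- The partition of `P j` into the long chain and the traces of the chains `Q i`. -/
noncomputable def pjLabel (k : ℕ) {j : ℕ} (x : PJ j) : ℕ :=
  if InLongChain k x then 0 else x.val.1.val

theorem qsize_cases (i : ℕ) : i = 1 ∧ qsize i = 3 ∨ i ≠ 1 ∧ qsize i = i + 1 := by
  unfold qsize
  split <;> simp_all

theorem PJ.ext_val {j : ℕ} {x y : PJ j} (h1 : x.val.1.val = y.val.1.val)
    (h2 : x.val.2.val = y.val.2.val) : x = y :=
  Subtype.ext (Prod.ext (Fin.ext h1) (Fin.ext h2))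

theorem PJ.exists_val {j i p : ℕ} (h1 : 1 ≤ i) (h2 : i ≤ j) (hp : p < qsize i) :
    ∃ x : PJ j, x.val.1.val = i ∧ x.val.2.val = p := by
  have := qsize_cases i
  exact ⟨⟨(⟨i, by omega⟩, ⟨p, by omega⟩), h1, h2, hp⟩, rfl, rfl⟩

theorem isAntichain_pjLevel {j k m : ℕ} (hm : m ∈ Finset.Icc 1 k) :
    IsAntichain (pjle j) {x | pjLevel k x = m} := by
  rintro x hx y hy hne (hxy : ple x y)
  change pjLevel k x = m at hx
  change pjLevel k y = m at hy
  have hne' : ¬ (x.val.1.val = y.val.1.val ∧ x.val.2.val = y.val.2.val) :=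
    fun h => hne (PJ.ext_val h.1 h.2)
  obtain ⟨⟨⟨a, ha⟩, ⟨p, hp⟩⟩, ha1, haj, hpa⟩ := x
  obtain ⟨⟨⟨b, hb⟩, ⟨q, hq⟩⟩, hb1, hbj, hqb⟩ := y
  simp only [pjLevel, ple, sposn, Finset.mem_Icc] at *
  have := qsize_cases a
  have := qsize_cases b
  have := qsize_cases k
  split_ifs at hx hy <;> grind

theorem isChain_pjLabel {j k : ℕ} (b : ℕ) :
    IsChain (pjle j) (pjLabel k ⁻¹' {b} : Set (PJ j)) := by
  rintro x hx y hy -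
  change ple x y ∨ ple y x
  change pjLabel k x = b at hx
  change pjLabel k y = b at hy
  have hqx := qsize_cases x.val.1.val
  have hqy := qsize_cases y.val.1.val
  have hx' := x.property
  have hy' := y.property
  unfold pjLabel at hx hy
  split_ifs at hx hy <;> simp only [InLongChain, ple, sposn] at * <;> omega

theorem exists_pjLabel_eq {j k : ℕ} (hj : 1 ≤ j) (hkj : k ≤ j + 1) (x : PJ j)
    (hx : pjLevel k x ∉ Finset.Icc 1 k) (m : ℕ) (hm : m ∈ Finset.Icc 1 k) :
    ∃ y : PJ j, pjLabel k y = pjLabel k x ∧ pjLevel k y = m := by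
  rw [Finset.mem_Icc] at hx hm
  obtain ⟨⟨⟨a, ha⟩, ⟨p, hp⟩⟩, ha1, haj, hpa⟩ := x
  have hqa := qsize_cases a
  have hqk := qsize_cases k
  have hqm := qsize_cases m
  have hqn := qsize_cases (min k j)
  dsimp only at ha1 haj hpa
  by_cases hak : a ≤ k
  · have hL : InLongChain (j := j) k ⟨(⟨a, ha⟩, ⟨p, hp⟩), ha1, haj, hpa⟩ := by
      simp only [pjLevel, InLongChain, sposn] at *
      split_ifs at hx <;> grind
    by_cases hmk : m < k
    · obtain ⟨y, hy1, hy2⟩ := PJ.exists_val (j := j) (i := m) (p := sposn m) hm.1 (by omega)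
        (by simp only [sposn]; omega)
      have hLy : InLongChain k y := by
        simp only [InLongChain, hy1, hy2, sposn]
        grind
      refine ⟨y, by simp only [pjLabel, if_pos hL, if_pos hLy], ?_⟩
      simp only [pjLevel, hy1, hy2, sposn]
      split_ifs <;> omega
    · obtain ⟨y, hy1, hy2⟩ := PJ.exists_val (j := j) (i := min k j) (p := qsize (min k j) - 1)
        (by omega) (by omega) (by omega)
      have hLy : InLongChain k y := by
        simp only [InLongChain, hy1, hy2, sposn]
        grind
      refine ⟨y, by simp only [pjLabel, if_pos hL, if_pos hLy], ?_⟩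
      simp only [pjLevel, hy1, hy2]
      split_ifs <;> grind
  · obtain ⟨y, hy1, hy2⟩ := PJ.exists_val (j := j) (i := a) (p := m - 1) ha1 haj (by omega)
    refine ⟨y, ?_, ?_⟩
    · simp only [pjLabel, InLongChain, hy1, hak, false_and, if_false]
    · simp only [pjLevel, hy1, hy2]
      split_ifs <;> omega

/-- In a `k`-saturated chain partition of `P j` with `1 ≤ k ≤ j + 1`, the element `u` lies on
the same chain as some `r i` with `i = k - 1` or `i = k`. -/
theorem exists_rElt_of_knorm_eq {j k : ℕ} (hj : 1 ≤ j) (hk : 1 ≤ k) (hkj : k ≤ j + 1)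
    {f : PJ j → PJ j} (hf : IsChainPartition (pjle j) f) (hs : knorm f k = dFam (pjle j) k) :
    ∃ (i : ℕ) (h1 : 1 ≤ i) (h2 : i ≤ j),
      (i + 1 = k ∨ i = k) ∧ f (uElt j hj) = f (rElt j i h1 h2) := by
  have hu : pjLevel k (uElt j hj) ∉ Finset.Icc 1 k := by
    have := qsize_cases k
    simp only [pjLevel, uElt, Finset.mem_Icc]
    split_ifs <;> grind
  obtain ⟨y, hfy, hy⟩ := exists_level_of_knorm_eq (fun m hm => isAntichain_pjLevel hm)
    (isChain_pjLabel (k := k)) (exists_pjLabel_eq hj hkj) hf hs hu (m := k) (by simp [hk])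
  have hne : uElt j hj ≠ y := by
    rintro rfl
    exact hu (by simp [hy, hk])
  have hcomp : ple (uElt j hj) y ∨ ple y (uElt j hj) := hf (f (uElt j hj)) rfl hfy hne
  have hy1 := y.property
  have hqy := qsize_cases y.val.1.val
  have hqk := qsize_cases k
  have hval : (y.val.1.val + 1 = k ∨ y.val.1.val = k) ∧
      y.val.2.val = qsize y.val.1.val - 1 := by
    have h0 : ¬ (1 = y.val.1.val ∧ 0 = y.val.2.val) := fun h => hne (PJ.ext_val h.1 h.2)
    simp only [ple, uElt, sposn] at hcomp
    simp only [pjLevel] at hy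
    split_ifs at hy <;> grind
  refine ⟨y.val.1.val, hy1.1, hy1.2.1, hval.1, ?_⟩
  rw [← hfy]
  congr 1
  exact PJ.ext_val rfl hval.2

/-- If `2 ≤ k ≤ j` and `f` is a `k`-saturated chain partition of `P j`, then `u` lies on
the same chain as `r (k-1)` or `r k`; in every `1`-saturated chain partition `u` lies on
the same chain as `r 1`; in every `(j+1)`-saturated chain partition `u` lies on the same
chain as `r j`. -/
theorem statement5 (j : ℕ) (hj : 1 ≤ j) :
    (∀ (k : ℕ) (hk2 : 2 ≤ k) (hkj : k ≤ j) (f : PJ j → PJ j),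
      IsChainPartition (pjle j) f → knorm f k = dFam (pjle j) k →
      f (uElt j hj) = f (rElt j (k - 1) (by omega) (by omega)) ∨
      f (uElt j hj) = f (rElt j k (by omega) hkj)) ∧
    (∀ f : PJ j → PJ j,
      IsChainPartition (pjle j) f → knorm f 1 = dFam (pjle j) 1 →
      f (uElt j hj) = f (rElt j 1 le_rfl hj)) ∧
    (∀ f : PJ j → PJ j,
      IsChainPartition (pjle j) f → knorm f (j + 1) = dFam (pjle j) (j + 1) →
      f (uElt j hj) = f (rElt j j hj le_rfl)) := by
  refine ⟨fun k hk2 hkj f hf hs => ?_, fun f hf hs => ?_, fun f hf hs => ?_⟩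
  · obtain ⟨i, h1, h2, hi, h⟩ := exists_rElt_of_knorm_eq hj (by omega) (by omega) hf hs
    rcases hi with rfl | rfl
    · exact Or.inl h
    · exact Or.inr h
  · obtain ⟨i, h1, h2, hi, h⟩ := exists_rElt_of_knorm_eq hj le_rfl (by omega) hf hs
    obtain rfl : i = 1 := by omega
    exact h
  · obtain ⟨i, h1, h2, hi, h⟩ := exists_rElt_of_knorm_eq hj (by omega) le_rfl hf hs
    obtain rfl : i = j := by omega
    exact h
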